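/- Let A be a positive integer with A ≡ 3 (mod 6). Suppose that for every positive integer i ≤ A with i ≡ 3 (mod 6), the odd density δ_i of the i-multipartition function exists, and suppose δ_A > 0. Then δ_3 > 0, i.e., the 3-multipartition (cubic partition) function p_3(n) has positive odd density. -/

import Mathlib

open Filter

/-- Number of `t`-tuples of partitions with total size `n`, i.e. the
`t`-multipartition function `p_t(n)`. -/
def multipartition (t n : ℕ) : ℕ :=
  ∑ v ∈ Finset.Nat.antidiagonalTuple t n, ∏ i, Fintype.card (Nat.Partition (v i))

/-- Number of `n ≤ x` with `multipartition t n` odd. -/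
def oddCount (t x : ℕ) : ℕ :=
  ((Finset.range (x + 1)).filter (fun n => Odd (multipartition t n))).card

/-- The odd density of the `t`-multipartition function exists and equals `δ`. -/
def hasOddDensity (t : ℕ) (δ : ℝ) : Prop :=
  Tendsto (fun x : ℕ => (oddCount t x : ℝ) / x) atTop (nhds δ)

open PowerSeries

/-- A set of natural numbers has density zero: its counting function is `o(x)`. -/
def DensityZero (S : Set ℕ) : Prop :=
  ∀ ε : ℝ, 0 < ε → ∃ C : ℝ, ∀ x : ℕ, ((S ∩ Set.Iio x).ncard : ℝ) ≤ ε * x + C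

theorem finite_inter_Iio (S : Set ℕ) (x : ℕ) : (S ∩ Set.Iio x).Finite :=
  (Set.finite_Iio x).inter_of_right S

theorem Set.Finite.densityZero {S : Set ℕ} (hS : S.Finite) : DensityZero S := by
  intro ε hε
  refine ⟨S.ncard, fun x => ?_⟩
  have h : ((S ∩ Set.Iio x).ncard : ℝ) ≤ S.ncard := by
    exact_mod_cast Set.ncard_le_ncard Set.inter_subset_left hS
  have : 0 ≤ ε * x := by positivity
  linarith

theorem DensityZero.union {S T : Set ℕ} (hS : DensityZero S) (hT : DensityZero T) :
    DensityZero (S ∪ T) := by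
  intro ε hε
  obtain ⟨C, hC⟩ := hS (ε / 2) (by positivity)
  obtain ⟨D, hD⟩ := hT (ε / 2) (by positivity)
  refine ⟨C + D, fun x => ?_⟩
  have h : (((S ∪ T) ∩ Set.Iio x).ncard : ℝ) ≤ (S ∩ Set.Iio x).ncard + (T ∩ Set.Iio x).ncard := by
    rw [Set.union_inter_distrib_right]
    exact_mod_cast Set.ncard_union_le _ _
  linarith [hC x, hD x]

/-- Density zero is inherited along injections that are bounded by a linear function. -/
theorem DensityZero.of_injOn {S T : Set ℕ} (hT : DensityZero T) (g : ℕ → ℕ) (K : ℕ)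
    (hinj : Set.InjOn g S) (hmaps : Set.MapsTo g S T) (hle : ∀ n, g n ≤ K * n) :
    DensityZero S := by
  intro ε hε
  obtain ⟨C, hC⟩ := hT (ε / (K + 1)) (by positivity)
  refine ⟨C + ε, fun x => ?_⟩
  have h : (S ∩ Set.Iio x).ncard ≤ (T ∩ Set.Iio (K * x + 1)).ncard := by
    refine Set.ncard_le_ncard_of_injOn g ?_ (hinj.mono Set.inter_subset_left)
      (finite_inter_Iio _ _)
    rintro n ⟨hn, hnx⟩
    refine ⟨hmaps hn, ?_⟩
    have : K * n ≤ K * x := Nat.mul_le_mul_left _ (le_of_lt hnx)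
    exact Nat.lt_succ_of_le ((hle n).trans this)
  have h' : ((S ∩ Set.Iio x).ncard : ℝ) ≤ (T ∩ Set.Iio (K * x + 1)).ncard := by exact_mod_cast h
  have h2 := hC (K * x + 1)
  have h3 : ε / (K + 1) * ((K * x + 1 : ℕ) : ℝ) ≤ ε * x + ε := by
    rw [div_mul_eq_mul_div, div_le_iff₀ (by positivity)]
    push_cast
    have h4 : 0 ≤ ε * (x : ℝ) := by positivity
    have h5 : 0 ≤ ε * (K : ℝ) := by positivity
    nlinarith
  linarith

theorem DensityZero.mono {S T : Set ℕ} (hT : DensityZero T) (h : S ⊆ T) : DensityZero S :=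
  hT.of_injOn id 1 (Set.injOn_id _) h (by simp)

/-- The set of exponents occurring in a power series. -/
def exponents {R : Type*} [Semiring R] (P : R⟦X⟧) : Set ℕ := {n | coeff n P ≠ 0}

theorem DensityZero.exponents_add {R : Type*} [Semiring R] {P Q : R⟦X⟧}
    (hP : DensityZero (exponents P)) (hQ : DensityZero (exponents Q)) :
    DensityZero (exponents (P + Q)) := by
  refine (hP.union hQ).mono fun n hn => ?_
  by_contra h
  simp only [exponents, Set.mem_union, Set.mem_ofPred_eq, not_or, not_not, ne_eq] at h hn
  simp [h.1, h.2] at hn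

theorem DensityZero.exponents_sum {R ι : Type*} [Semiring R] (s : Finset ι) {P : ι → R⟦X⟧}
    (hP : ∀ i ∈ s, DensityZero (exponents (P i))) :
    DensityZero (exponents (∑ i ∈ s, P i)) := by
  classical
  induction s using Finset.induction_on with
  | empty => exact Set.Finite.densityZero (by simp [exponents])
  | insert a s ha ih =>
    rw [Finset.sum_insert ha]
    exact (hP a (by simp)).exponents_add (ih fun i hi => hP i (by simp [hi]))

theorem DensityZero.exponents_C_mul {R : Type*} [Semiring R] {P : R⟦X⟧}
    (hP : DensityZero (exponents P)) (c : R) : DensityZero (exponents (C c * P)) :=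
  hP.mono fun n hn h => hn (by simp [h])

theorem DensityZero.exponents_X_pow_mul {R : Type*} [Semiring R] {P : R⟦X⟧}
    (hP : DensityZero (exponents P)) (k : ℕ) : DensityZero (exponents (X ^ k * P)) := by
  have key : ∀ n ∈ exponents (X ^ k * P), k ≤ n ∧ n - k ∈ exponents P := by
    intro n hn
    simp only [exponents, Set.mem_ofPred_eq, coeff_X_pow_mul', ne_eq, ite_eq_right_iff,
      Classical.not_imp] at hn
    exact hn
  refine hP.of_injOn (fun n => n - k) 1 ?_ (fun n hn => (key n hn).2) (fun n => by lia)
  intro a ha b hb hab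
  have := (key a ha).1
  have := (key b hb).1
  simp only at hab
  lia

theorem mem_exponents_expand {R : Type*} [CommRing R] {P : R⟦X⟧} {p : ℕ} (hp : p ≠ 0) {n : ℕ} :
    n ∈ exponents (P.expand p hp) ↔ p ∣ n ∧ n / p ∈ exponents P := by
  simp [exponents, coeff_expand]

theorem densityZero_exponents_expand {R : Type*} [CommRing R] {P : R⟦X⟧} {p : ℕ} (hp : p ≠ 0) :
    DensityZero (exponents (P.expand p hp)) ↔ DensityZero (exponents P) := by
  constructor
  · intro h
    refine h.of_injOn (fun n => p * n) p ?_ ?_ (fun n => le_rfl)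
    · exact (mul_right_injective₀ hp).injOn
    · intro n hn
      rw [mem_exponents_expand]
      simpa [Nat.mul_div_cancel_left n (Nat.pos_of_ne_zero hp)] using hn
  · intro h
    refine h.of_injOn (fun n => n / p) 1 ?_ ?_ (fun n => by simpa using Nat.div_le_self n p)
    · intro a ha b hb hab
      rw [mem_exponents_expand] at ha hb
      exact (Nat.div_left_inj ha.1 hb.1).mp hab
    · intro n hn
      exact ((mem_exponents_expand hp).mp hn).2

/-- The operator keeping the coefficients at multiples of `p`. -/
noncomputable def dissect {R : Type*} [Semiring R] (p : ℕ) (P : R⟦X⟧) : R⟦X⟧ :=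
  PowerSeries.mk fun n => coeff (p * n) P

theorem DensityZero.exponents_dissect {R : Type*} [Semiring R] {P : R⟦X⟧}
    (hP : DensityZero (exponents P)) {p : ℕ} (hp : p ≠ 0) :
    DensityZero (exponents (dissect p P)) :=
  hP.of_injOn (fun n => p * n) p (mul_right_injective₀ hp).injOn
    (fun n hn => by simpa [exponents, dissect] using hn) (fun _ => le_rfl)

theorem sq_eq_expand_of_zmod_two (P : (ZMod 2)⟦X⟧) : P ^ 2 = P.expand 2 two_ne_zero := by
  have h := MvPowerSeries.map_frobenius_expand 2 two_ne_zero (f := P)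
  rw [ZMod.frobenius_zmod] at h
  rw [← h]
  rw [show MvPowerSeries.map (RingHom.id (ZMod 2)) = RingHom.id (MvPowerSeries Unit (ZMod 2)) from
    MvPowerSeries.map_id]
  rfl

theorem densityZero_exponents_sq {P : (ZMod 2)⟦X⟧} :
    DensityZero (exponents (P ^ 2)) ↔ DensityZero (exponents P) := by
  rw [sq_eq_expand_of_zmod_two, densityZero_exponents_expand]

theorem densityZero_exponents_pow_eight {P : (ZMod 2)⟦X⟧} :
    DensityZero (exponents (P ^ 8)) ↔ DensityZero (exponents P) := by
  rw [show P ^ 8 = ((P ^ 2) ^ 2) ^ 2 by ring, densityZero_exponents_sq,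
    densityZero_exponents_sq, densityZero_exponents_sq]

theorem densityZero_iff_tendsto (S : Set ℕ) :
    DensityZero S ↔
      Tendsto (fun x : ℕ => ((S ∩ Set.Iio (x + 1)).ncard : ℝ) / x) atTop (nhds 0) := by
  constructor
  · intro h
    rw [Metric.tendsto_atTop]
    intro ε hε
    obtain ⟨C, hC⟩ := h (ε / 2) (by positivity)
    obtain ⟨N, hN⟩ := exists_nat_gt ((ε / 2 + C) / (ε / 2))
    refine ⟨N + 1, fun x hx => ?_⟩
    have hx0 : (0 : ℝ) < x := by exact_mod_cast (by lia : 0 < x)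
    have hNx : (N : ℝ) ≤ x := by exact_mod_cast (by lia : N ≤ x)
    rw [dist_zero_right, Real.norm_of_nonneg (by positivity), div_lt_iff₀ hx0]
    have h1 := hC (x + 1)
    rw [div_lt_iff₀ (by positivity)] at hN
    push_cast at h1
    nlinarith
  · intro h ε hε
    rw [Metric.tendsto_atTop] at h
    obtain ⟨N, hN⟩ := h ε hε
    refine ⟨N + 1, fun x => ?_⟩
    have hmono : (S ∩ Set.Iio x).ncard ≤ x := by
      simpa using Set.ncard_le_ncard (Set.inter_subset_right (s := S)) (Set.finite_Iio x)
    have hmono' : (S ∩ Set.Iio x).ncard ≤ (S ∩ Set.Iio (x + 1)).ncard :=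
      Set.ncard_le_ncard (Set.inter_subset_inter_right _ (Set.Iio_subset_Iio (by lia)))
        (finite_inter_Iio _ _)
    have h0 : 0 ≤ ε * x := by positivity
    rcases lt_or_ge x (N + 1) with hx | hx
    · have h1 : ((S ∩ Set.Iio x).ncard : ℝ) ≤ N + 1 := by exact_mod_cast hmono.trans hx.le
      linarith
    · have hx0 : (0 : ℝ) < x := by exact_mod_cast (by lia : 0 < x)
      have h1 := hN x (by lia)
      rw [dist_zero_right, Real.norm_of_nonneg (by positivity), div_lt_iff₀ hx0] at h1
      have h2 : ((S ∩ Set.Iio x).ncard : ℝ) ≤ (S ∩ Set.Iio (x + 1)).ncard := by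
        exact_mod_cast hmono'
      have : (0 : ℝ) ≤ N := by positivity
      linarith

/-- The power series `P`, evaluated at the complex number `q`, converges to `v`. -/
def EvalsTo (P : ℤ⟦X⟧) (q v : ℂ) : Prop :=
  HasSum (fun n : ℕ => ((coeff n P : ℤ) : ℂ) * q ^ n) v

namespace EvalsTo

variable {P Q : ℤ⟦X⟧} {q v w : ℂ}

theorem add (hP : EvalsTo P q v) (hQ : EvalsTo Q q w) : EvalsTo (P + Q) q (v + w) := by
  have h := HasSum.add hP hQ
  unfold EvalsTo
  convert h using 2 with n
  simp [add_mul]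

theorem mul (hP : EvalsTo P q v) (hQ : EvalsTo Q q w) : EvalsTo (P * Q) q (v * w) := by
  have hs := summable_norm_sum_mul_antidiagonal_of_summable_norm hP.summable.norm hQ.summable.norm
  have h := tsum_mul_tsum_eq_tsum_sum_antidiagonal_of_summable_norm hP.summable.norm
    hQ.summable.norm
  rw [hP.tsum_eq, hQ.tsum_eq] at h
  rw [h]
  refine hs.of_norm.hasSum.congr_fun fun n => ?_
  rw [coeff_mul]
  push_cast
  rw [Finset.sum_mul]
  refine Finset.sum_congr rfl fun ij hij => ?_
  rw [← Finset.HasAntidiagonal.mem_antidiagonal.mp hij, pow_add]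
  ring

theorem C (c : ℤ) (q : ℂ) : EvalsTo (PowerSeries.C c) q c := by
  have h := hasSum_single (f := fun n : ℕ => ((coeff n (PowerSeries.C c) : ℤ) : ℂ) * q ^ n) 0
    (fun n hn => by rw [coeff_C, if_neg hn]; simp)
  rw [coeff_C, if_pos rfl, pow_zero, mul_one] at h
  exact h

theorem X (q : ℂ) : EvalsTo (PowerSeries.X : ℤ⟦X⟧) q q := by
  have h := hasSum_single (f := fun n : ℕ => ((coeff n (PowerSeries.X : ℤ⟦X⟧) : ℤ) : ℂ) * q ^ n) 1
    (fun n hn => by simp [coeff_X, hn])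
  simpa [EvalsTo] using h

theorem pow (hP : EvalsTo P q v) (k : ℕ) : EvalsTo (P ^ k) q (v ^ k) := by
  induction k with
  | zero => simpa using C 1 q
  | succ k ih => simpa [pow_succ] using ih.mul hP

theorem sub (hP : EvalsTo P q v) (hQ : EvalsTo Q q w) : EvalsTo (P - Q) q (v - w) := by
  simpa [sub_eq_add_neg] using hP.add ((C (-1) q).mul hQ)

theorem expand {p : ℕ} (hp : p ≠ 0) (hP : EvalsTo P (q ^ p) v) : EvalsTo (P.expand p hp) q v := by
  have hinj : Function.Injective fun n : ℕ => p * n := mul_right_injective₀ hp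
  refine (hinj.hasSum_iff fun n hn => ?_).mp ?_
  · rw [coeff_expand, if_neg]
    · simp
    · rintro ⟨m, rfl⟩
      exact hn ⟨m, rfl⟩
  · refine HasSum.congr_fun hP fun n => ?_
    simp [coeff_expand, pow_mul, Nat.mul_div_cancel_left n (Nat.pos_of_ne_zero hp)]

theorem of_X_mul (hq : q ≠ 0) (h : EvalsTo (PowerSeries.X * P) q v) : EvalsTo P q (v / q) := by
  have h' := (hasSum_nat_add_iff' 1).mpr h
  simp only [Finset.range_one, Finset.sum_singleton, coeff_zero_X_mul, Int.cast_zero, zero_mul,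
    sub_zero, coeff_succ_X_mul] at h'
  refine (h'.div_const q).congr_fun fun n => ?_
  rw [pow_succ, ← mul_assoc, mul_div_cancel_right₀ _ hq]

end EvalsTo

/-- Averaging the values of a power series over the `p`-th roots of `q` picks the exponents
divisible by `p`. -/
theorem evalsTo_dissect_of_sum {P : ℤ⟦X⟧} {p : ℕ} (hp : p ≠ 0) {q : ℂ} {r v : ℕ → ℂ}
    (hr : ∀ n, ∑ b ∈ Finset.range p, r b ^ n = if p ∣ n then p * q ^ (n / p) else 0)
    (h : ∀ b ∈ Finset.range p, EvalsTo P (r b) (v b)) :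
    EvalsTo (PowerSeries.C (p : ℤ) * dissect p P) q (∑ b ∈ Finset.range p, v b) := by
  have hs := hasSum_sum h
  simp_rw [← Finset.mul_sum, hr] at hs
  have hinj : Function.Injective fun n : ℕ => p * n := mul_right_injective₀ hp
  have h2 := (hinj.hasSum_iff (fun n hn => ?_)).mpr hs
  · refine h2.congr_fun fun n => ?_
    rw [coeff_C_mul]
    simp [dissect, Nat.mul_div_cancel_left n (Nat.pos_of_ne_zero hp)]
    ring
  · rw [if_neg, mul_zero]
    rintro ⟨m, rfl⟩
    exact hn ⟨m, rfl⟩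

/-- The generating function of the partition function. -/
noncomputable def partitionSeries : ℤ⟦X⟧ :=
  PowerSeries.mk fun n => (Fintype.card (Nat.Partition n) : ℤ)

/-- The generating function of partitions into parts of size at most `M`. -/
noncomputable def boundedPartitionSeries (M : ℕ) : ℤ⟦X⟧ :=
  ∏ i ∈ Finset.range M, (PowerSeries.mk 1 : ℤ⟦X⟧).expand (i + 1) i.succ_ne_zero

theorem coeff_expand_mk_one_nonneg (i n : ℕ) :
    0 ≤ coeff n ((PowerSeries.mk 1 : ℤ⟦X⟧).expand (i + 1) i.succ_ne_zero) := by
  rw [coeff_expand]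
  split_ifs <;> simp

theorem coeff_boundedPartitionSeries_nonneg (M n : ℕ) :
    0 ≤ coeff n (boundedPartitionSeries M) := by
  induction M generalizing n with
  | zero =>
    simp only [boundedPartitionSeries, Finset.range_zero, Finset.prod_empty, coeff_one]
    split_ifs <;> simp
  | succ M ih =>
    rw [boundedPartitionSeries, Finset.prod_range_succ, coeff_mul]
    exact Finset.sum_nonneg fun ij _ => mul_nonneg (ih _) (coeff_expand_mk_one_nonneg _ _)

theorem coeff_boundedPartitionSeries_mono (n : ℕ) :
    Monotone fun M => coeff n (boundedPartitionSeries M) := by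
  refine monotone_nat_of_le_succ fun M => ?_
  rw [boundedPartitionSeries, boundedPartitionSeries, Finset.prod_range_succ, coeff_mul]
  refine le_trans ?_ (Finset.single_le_sum (f := fun ij : ℕ × ℕ =>
    coeff ij.1 (boundedPartitionSeries M) *
      coeff ij.2 ((PowerSeries.mk 1 : ℤ⟦X⟧).expand (M + 1) M.succ_ne_zero))
    (fun ij _ => mul_nonneg (coeff_boundedPartitionSeries_nonneg _ _)
      (coeff_expand_mk_one_nonneg _ _)) (a := (n, 0)) (by simp))
  simp [boundedPartitionSeries, coeff_expand]

open scoped PowerSeries.WithPiTopology in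
theorem eventually_coeff_boundedPartitionSeries (n : ℕ) :
    ∀ᶠ M in atTop, coeff n (boundedPartitionSeries M) = coeff n partitionSeries := by
  have h := Nat.Partition.hasProd_powerSeriesMk_card_restricted ℤ (fun _ => True)
  have hG : ∀ i : ℕ, (∑' j : ℕ, (PowerSeries.X : ℤ⟦X⟧) ^ ((i + 1) * j)) =
      (PowerSeries.mk 1 : ℤ⟦X⟧).expand (i + 1) i.succ_ne_zero := by
    intro i
    have h1 := PowerSeries.WithPiTopology.tsum_pow_mul_one_sub_of_constantCoeff_eq_zero
      (f := (PowerSeries.X : ℤ⟦X⟧) ^ (i + 1)) (by simp)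
    have h2 := congrArg (PowerSeries.expand (i + 1) i.succ_ne_zero)
      (PowerSeries.mk_one_mul_one_sub_eq_one ℤ)
    simp only [map_mul, map_sub, map_one, expand_X] at h2
    simp only [pow_mul]
    exact left_inv_eq_right_inv h1 ((mul_comm _ _).trans h2)
  have ht := h.tendsto_prod_nat
  rw [PowerSeries.WithPiTopology.tendsto_iff_coeff_tendsto] at ht
  have h3 := ht n
  rw [nhds_discrete, tendsto_pure] at h3
  filter_upwards [h3] with M hM
  simpa [boundedPartitionSeries, partitionSeries, hG, Nat.Partition.restricted] using hM

theorem coeff_boundedPartitionSeries_le (M n : ℕ) :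
    coeff n (boundedPartitionSeries M) ≤ coeff n partitionSeries := by
  obtain ⟨K, hK⟩ := (eventually_coeff_boundedPartitionSeries n).exists_forall_of_atTop
  rw [← hK (max K M) (le_max_left _ _)]
  exact coeff_boundedPartitionSeries_mono n (le_max_right _ _)

theorem evalsTo_mk_one {q : ℂ} (hq : ‖q‖ < 1) : EvalsTo (PowerSeries.mk 1) q (1 - q)⁻¹ := by
  simpa [EvalsTo] using hasSum_geometric_of_norm_lt_one hq

theorem evalsTo_boundedPartitionSeries {q : ℂ} (hq : ‖q‖ < 1) (M : ℕ) :
    EvalsTo (boundedPartitionSeries M) q (∏ i ∈ Finset.range M, (1 - q ^ (i + 1)))⁻¹ := by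
  induction M with
  | zero => simpa [boundedPartitionSeries] using EvalsTo.C 1 q
  | succ M ih =>
    rw [boundedPartitionSeries, Finset.prod_range_succ, Finset.prod_range_succ, mul_inv]
    refine ih.mul (EvalsTo.expand _ (evalsTo_mk_one ?_))
    rw [norm_pow]
    exact pow_lt_one₀ (norm_nonneg _) hq M.succ_ne_zero

theorem tprod_one_sub_pow_ne_zero {q : ℂ} (hq : ‖q‖ < 1) : ∏' i : ℕ, (1 - q ^ (i + 1)) ≠ 0 := by
  refine tprod_one_add_ne_zero_of_summable (f := fun n : ℕ => -q ^ (n + 1)) (fun i h => ?_) ?_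
  · have h1 : ‖q ^ (i + 1)‖ < 1 := by
      rw [norm_pow]
      exact pow_lt_one₀ (norm_nonneg _) hq i.succ_ne_zero
    rw [← sub_eq_add_neg, sub_eq_zero] at h
    simp [← h] at h1
  · simpa using (summable_nat_add_iff 1).mpr (summable_geometric_of_lt_one (norm_nonneg _) hq)

theorem tendsto_inv_prod_one_sub_pow {q : ℂ} (hq : ‖q‖ < 1) :
    Tendsto (fun M : ℕ => (∏ i ∈ Finset.range M, (1 - q ^ (i + 1)))⁻¹) atTop
      (nhds (∏' i : ℕ, (1 - q ^ (i + 1)))⁻¹) :=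
  (ModularForm.multipliable_one_sub_pow hq).hasProd.tendsto_prod_nat.inv₀
    (tprod_one_sub_pow_ne_zero hq)

theorem summable_partitionSeries {q : ℂ} (hq : ‖q‖ < 1) :
    Summable fun n : ℕ => ((coeff n partitionSeries : ℤ) : ℝ) * ‖q‖ ^ n := by
  have hq' : ‖((‖q‖ : ℝ) : ℂ)‖ < 1 := by simpa using hq
  obtain ⟨C, hC⟩ := (tendsto_inv_prod_one_sub_pow hq').norm.bddAbove_range
  have hnonneg : ∀ n, 0 ≤ coeff n partitionSeries := fun n =>
    (coeff_boundedPartitionSeries_nonneg 0 n).trans (coeff_boundedPartitionSeries_le 0 n)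
  refine summable_of_sum_range_le (c := C) (fun n => ?_) fun N => ?_
  · have : (0 : ℝ) ≤ ((coeff n partitionSeries : ℤ) : ℝ) := by exact_mod_cast hnonneg n
    positivity
  · obtain ⟨M, hM⟩ := (eventually_all_finset (Finset.range N) |>.mpr
      fun n _ => eventually_coeff_boundedPartitionSeries n).exists
    refine le_trans ?_ (hC ⟨M, rfl⟩)
    have hs := evalsTo_boundedPartitionSeries hq' M
    have hs' : HasSum (fun n => ((coeff n (boundedPartitionSeries M) : ℤ) : ℝ) * ‖q‖ ^ n)
        (∏ i ∈ Finset.range M, (1 - ‖q‖ ^ (i + 1)))⁻¹ := by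
      unfold EvalsTo at hs
      exact_mod_cast hs
    have hle := hs'.summable.sum_le_tsum (Finset.range N) (fun n _ => by
      have : (0 : ℝ) ≤ ((coeff n (boundedPartitionSeries M) : ℤ) : ℝ) := by
        exact_mod_cast coeff_boundedPartitionSeries_nonneg M n
      positivity)
    rw [hs'.tsum_eq] at hle
    calc _ = ∑ n ∈ Finset.range N, ((coeff n (boundedPartitionSeries M) : ℤ) : ℝ) * ‖q‖ ^ n :=
          Finset.sum_congr rfl fun n hn => by rw [hM n hn]
      _ ≤ _ := hle
      _ ≤ _ := by
        refine (le_abs_self _).trans (le_of_eq ?_)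
        rw [← Real.norm_eq_abs, ← Complex.norm_real]
        push_cast
        rfl

theorem evalsTo_partitionSeries {q : ℂ} (hq : ‖q‖ < 1) :
    EvalsTo partitionSeries q (∏' i : ℕ, (1 - q ^ (i + 1)))⁻¹ := by
  have hbound := summable_partitionSeries hq
  have hnorm : ∀ n, ‖((coeff n partitionSeries : ℤ) : ℂ) * q ^ n‖ =
      ((coeff n partitionSeries : ℤ) : ℝ) * ‖q‖ ^ n := by
    intro n
    simp [partitionSeries]
  have hsum : Summable fun n : ℕ => ((coeff n partitionSeries : ℤ) : ℂ) * q ^ n :=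
    Summable.of_norm (by simpa only [hnorm] using hbound)
  have hlim := tendsto_tsum_of_dominated_convergence (𝓕 := atTop)
    (f := fun (M n : ℕ) => ((coeff n (boundedPartitionSeries M) : ℤ) : ℂ) * q ^ n)
    (g := fun n : ℕ => ((coeff n partitionSeries : ℤ) : ℂ) * q ^ n) hbound
    (fun n => by
      refine tendsto_const_nhds.congr' ?_
      filter_upwards [eventually_coeff_boundedPartitionSeries n] with M hM
      rw [hM])
    (Eventually.of_forall fun M n => by
      rw [norm_mul, norm_pow, Complex.norm_intCast]
      gcongr
      rw [abs_of_nonneg (by exact_mod_cast coeff_boundedPartitionSeries_nonneg M n)]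
      exact_mod_cast coeff_boundedPartitionSeries_le M n)
  simp only [(evalsTo_boundedPartitionSeries hq _).tsum_eq] at hlim
  unfold EvalsTo
  rw [tendsto_nhds_unique (tendsto_inv_prod_one_sub_pow hq) hlim]
  exact hsum.hasSum

/-- A holomorphic function on the upper half plane invariant under `SL(2, ℤ)`, seen as a function
on `ℂ`. -/
structure IsModularFunction (F : ℂ → ℂ) : Prop where
  differentiableOn : DifferentiableOn ℂ F {z | 0 < z.im}
  add_one : ∀ z : ℂ, 0 < z.im → F (z + 1) = F z
  neg_inv : ∀ z : ℂ, 0 < z.im → F (-z⁻¹) = F z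

namespace IsModularFunction

open UpperHalfPlane ModularForm MatrixGroups CongruenceSubgroup ModularGroup

variable {F G : ℂ → ℂ}

theorem sub (hF : IsModularFunction F) (hG : IsModularFunction G) :
    IsModularFunction fun z => F z - G z where
  differentiableOn := hF.differentiableOn.sub hG.differentiableOn
  add_one z hz := by rw [hF.add_one z hz, hG.add_one z hz]
  neg_inv z hz := by rw [hF.neg_inv z hz, hG.neg_inv z hz]

theorem const_mul_pow (hF : IsModularFunction F) (c : ℂ) (k : ℕ) :
    IsModularFunction fun z => c * F z ^ k where
  differentiableOn := (hF.differentiableOn.pow k).const_mul c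
  add_one z hz := by rw [hF.add_one z hz]
  neg_inv z hz := by rw [hF.neg_inv z hz]

theorem slash (hF : IsModularFunction F) (γ : SL(2, ℤ)) :
    (fun z : ℍ => F z) ∣[(0 : ℤ)] γ = fun z : ℍ => F z := by
  refine SlashInvariantForm.slash_action_generators_SL2Z ?_ ?_ γ
  · ext z
    rw [SL_slash_apply, modular_S_smul]
    simpa [inv_neg] using hF.neg_inv z z.2
  · ext z
    rw [SL_slash_apply, modular_T_smul]
    simpa [add_comm] using hF.add_one z z.2

theorem moebius (hF : IsModularFunction F) {a b c d : ℤ} (h : a * d - b * c = 1) {z : ℂ}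
    (hz : 0 < z.im) : F ((a * z + b) / (c * z + d)) = F z := by
  let γ : SL(2, ℤ) := ⟨!![a, b; c, d], by rw [Matrix.det_fin_two_of, h]⟩
  have h1 := congrFun (hF.slash γ) ⟨z, hz⟩
  rw [SL_slash_apply, coe_specialLinearGroup_apply] at h1
  simpa [γ] using h1

theorem isBoundedAtImInfty {P : ℤ⟦X⟧}
    (h : ∀ z : ℂ, 0 < z.im → EvalsTo P (Function.Periodic.qParam 1 z) (F z)) :
    IsBoundedAtImInfty fun z : ℍ => F z :=
  isBoundedAtImInfty_of_hasSum_qExpansion one_pos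
    (c := fun n => ((coeff n P : ℤ) : ℂ)) fun τ => h τ τ.2

/-- A modular function without pole at infinity, as a modular form of weight zero. -/
noncomputable def toModularForm (hF : IsModularFunction F)
    (hb : IsBoundedAtImInfty fun z : ℍ => F z) : ModularForm 𝒮ℒ 0 where
  toFun z := F z
  slash_action_eq' A hA := by
    obtain ⟨A, rfl⟩ := hA
    exact hF.slash A
  holo' := by
    rw [UpperHalfPlane.mdifferentiable_iff]
    exact hF.differentiableOn.congr fun z hz => by simp [ofComplex_apply_of_im_pos hz]
  bdd_at_cusps' hc := by
    rw [Subgroup.IsArithmetic.isCusp_iff_isCusp_SL2Z] at hc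
    rw [OnePoint.isBoundedAt_iff_forall_SL2Z hc]
    intro γ _
    rw [hF.slash]
    exact hb

/-- A power series that evaluates to a modular function is constant. -/
theorem eq_C_of_evalsTo (hF : IsModularFunction F) {P : ℤ⟦X⟧}
    (h : ∀ z : ℂ, 0 < z.im → EvalsTo P (Function.Periodic.qParam 1 z) (F z)) :
    P = C (coeff 0 P) := by
  let f := hF.toModularForm (isBoundedAtImInfty h)
  obtain ⟨c, hc⟩ := ModularFormClass.levelOne_weight_zero_const f
  have h1 := ModularFormClass.qExpansion_coeff_unique (f := f) one_pos one_mem_strictPeriods_SL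
    (c := fun n => ((coeff n P : ℤ) : ℂ)) fun τ => h τ τ.2
  have h2 := ModularFormClass.qExpansion_coeff_unique (f := f) one_pos one_mem_strictPeriods_SL
    (c := fun n => if n = 0 then c else 0) fun τ => by
      rw [hc]
      have h3 := hasSum_single (0 : ℕ) (f := fun n : ℕ =>
        (if n = 0 then c else 0) • Function.Periodic.qParam 1 τ ^ n) (by simp +contextual)
      simpa using h3
  ext n
  rw [coeff_C]
  split_ifs with hn
  · rw [hn]
  · have h3 := (h1 n).trans (h2 n).symm
    simpa [hn] using h3

/-- A modular function with a pole of order at most `N` at infinity is a polynomial in any modular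
function with a simple pole at infinity and leading coefficient one. -/
theorem exists_eq_sum_of_evalsTo {j : ℂ → ℂ} {J : ℤ⟦X⟧} (hj : IsModularFunction j)
    (hJ : ∀ z : ℂ, 0 < z.im → EvalsTo J (Function.Periodic.qParam 1 z)
      (j z * Function.Periodic.qParam 1 z)) (hJ0 : coeff 0 J = 1)
    (N : ℕ) {F : ℂ → ℂ} (hF : IsModularFunction F) {P : ℤ⟦X⟧}
    (hP : ∀ z : ℂ, 0 < z.im → EvalsTo P (Function.Periodic.qParam 1 z)
      (F z * Function.Periodic.qParam 1 z ^ N)) :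
    ∃ c : ℕ → ℤ, c N = coeff 0 P ∧
      P = ∑ i ∈ Finset.range (N + 1), C (c i) * (X ^ (N - i) * J ^ i) := by
  induction N generalizing F P with
  | zero =>
    refine ⟨fun _ => coeff 0 P, rfl, ?_⟩
    have := hF.eq_C_of_evalsTo (P := P) (by simpa using hP)
    simpa using this
  | succ N ih =>
    have hX : X ∣ P - C (coeff 0 P) * J ^ (N + 1) := by
      rw [X_dvd_iff, ← coeff_zero_eq_constantCoeff_apply, map_sub, coeff_C_mul]
      rw [coeff_zero_eq_constantCoeff_apply] at hJ0
      simp [hJ0]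
    obtain ⟨P', hP'⟩ := hX
    obtain ⟨c, -, hc⟩ := ih (hF.sub (hj.const_mul_pow (coeff 0 P : ℤ) (N + 1))) (P := P')
      fun z hz => by
        have hq : Function.Periodic.qParam 1 z ≠ 0 := Function.Periodic.qParam_ne_zero z
        have h1 := (hP z hz).sub ((EvalsTo.C (coeff 0 P) _).mul ((hJ z hz).pow (N + 1)))
        rw [hP'] at h1
        convert h1.of_X_mul hq using 1
        field_simp
        ring
    refine ⟨fun i => if i = N + 1 then coeff 0 P else c i, by simp, ?_⟩
    rw [Finset.sum_range_succ, ← sub_eq_iff_eq_add]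
    simp only [if_true, tsub_self, pow_zero, one_mul]
    rw [hP', hc, Finset.mul_sum]
    refine Finset.sum_congr rfl fun i hi => ?_
    have hi' := Finset.mem_range.mp hi
    rw [if_neg (by lia), show N + 1 - i = (N - i) + 1 by lia, pow_succ]
    ring

end IsModularFunction

/-- The Hecke operator `T_p` in weight zero, multiplied by `p`. -/
noncomputable def heckeOperator (p : ℕ) (F : ℂ → ℂ) (z : ℂ) : ℂ :=
  F (p * z) + ∑ b ∈ Finset.range p, F ((z + b) / p)

theorem im_natCast_mul {p : ℕ} (hp : 0 < p) {z : ℂ} (hz : 0 < z.im) : 0 < ((p : ℂ) * z).im := by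
  simp only [Complex.mul_im, Complex.natCast_re, Complex.natCast_im, zero_mul, add_zero]
  positivity

theorem im_add_div_natCast {p : ℕ} (hp : 0 < p) (b : ℕ) {z : ℂ} (hz : 0 < z.im) :
    0 < ((z + b) / (p : ℂ)).im := by
  rw [Complex.div_natCast_im]
  simp only [Complex.add_im, Complex.natCast_im, add_zero]
  positivity

theorem im_neg_inv {z : ℂ} (hz : 0 < z.im) : 0 < (-z⁻¹).im := by
  have := UpperHalfPlane.im_inv_neg_coe_pos ⟨z, hz⟩
  simpa [inv_neg] using this

namespace IsModularFunction

variable {F : ℂ → ℂ}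

theorem add_natCast (hF : IsModularFunction F) {z : ℂ} (hz : 0 < z.im) (n : ℕ) :
    F (z + n) = F z := by
  induction n with
  | zero => simp
  | succ n ih =>
    rw [← ih, ← hF.add_one (z + n) (by simpa using hz)]
    push_cast
    ring_nf

/-- Under `z ↦ -1 / z`, the summand of the Hecke operator at `b` moves to the one at `b'`, where
`b * b' ≡ -1 (mod p)`. -/
theorem heckeOperator_summand_neg_inv (hF : IsModularFunction F) {p b b' k : ℕ} (hp : 0 < p)
    (h : b * b' + 1 = p * k) {z : ℂ} (hz : 0 < z.im) :
    F ((-z⁻¹ + b) / p) = F ((z + b') / p) := by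
  have hz0 : z ≠ 0 := by
    rintro rfl
    simp at hz
  have hp0 : (p : ℂ) ≠ 0 := by exact_mod_cast hp.ne'
  have hdet : (b : ℤ) * (-b') - (-k) * p = 1 := by
    have : (b : ℤ) * b' + 1 = p * k := by exact_mod_cast h
    linarith
  rw [← hF.moebius hdet (im_add_div_natCast hp b' hz)]
  congr 1
  have h1 : ((p : ℤ) : ℂ) * ((z + b') / p) + ((-(b' : ℤ) : ℤ) : ℂ) = z := by
    push_cast
    field_simp
    ring
  rw [h1]
  have h2 : (b : ℂ) * b' + 1 = p * k := by exact_mod_cast h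
  push_cast
  field_simp
  linear_combination (-1 : ℂ) * h2

theorem sum_heckeOperator_neg_inv (hF : IsModularFunction F) {p : ℕ} (hp : p.Prime) {z : ℂ}
    (hz : 0 < z.im) :
    ∑ b ∈ (Finset.range p).erase 0, F ((-z⁻¹ + b) / p) =
      ∑ b ∈ (Finset.range p).erase 0, F ((z + b) / p) := by
  have : Fact p.Prime := ⟨hp⟩
  let g : ℕ → ℕ := fun b => (-(b : ZMod p)⁻¹).val
  have hne : ∀ b ∈ (Finset.range p).erase 0, (b : ZMod p) ≠ 0 := by
    intro b hb h0
    rw [Finset.mem_erase, Finset.mem_range] at hb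
    exact hb.1 (Nat.eq_zero_of_dvd_of_lt ((ZMod.natCast_eq_zero_iff b p).mp h0) hb.2)
  have hg : ∀ b, ((g b : ℕ) : ZMod p) = -(b : ZMod p)⁻¹ := fun b => ZMod.natCast_zmod_val _
  have hmem : ∀ b ∈ (Finset.range p).erase 0, g b ∈ (Finset.range p).erase 0 := by
    intro b hb
    rw [Finset.mem_erase, Finset.mem_range]
    refine ⟨fun h0 => hne b hb ?_, ZMod.val_lt _⟩
    have := hg b
    rw [h0] at this
    simpa using this.symm
  have hinv : ∀ b ∈ (Finset.range p).erase 0, g (g b) = b := by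
    intro b hb
    rw [Finset.mem_erase, Finset.mem_range] at hb
    change (-((g b : ℕ) : ZMod p)⁻¹).val = b
    rw [hg, inv_neg, inv_inv, neg_neg, ZMod.val_cast_of_lt hb.2]
  refine Finset.sum_bij' (fun b _ => g b) (fun b _ => g b) hmem hmem hinv hinv fun b hb => ?_
  have h0 : ((b * g b + 1 : ℕ) : ZMod p) = 0 := by
    push_cast
    rw [hg, mul_neg, mul_inv_cancel₀ (hne b hb)]
    ring
  obtain ⟨k, hk⟩ := (ZMod.natCast_eq_zero_iff _ p).mp h0
  exact hF.heckeOperator_summand_neg_inv hp.pos hk hz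

theorem heckeOperator (hF : IsModularFunction F) {p : ℕ} (hp : p.Prime) :
    IsModularFunction (heckeOperator p F) where
  differentiableOn := by
    refine DifferentiableOn.add ?_ (DifferentiableOn.fun_sum fun b _ => ?_)
    · exact hF.differentiableOn.comp (by fun_prop) fun z hz => im_natCast_mul hp.pos hz
    · exact hF.differentiableOn.comp (by fun_prop) fun z hz => im_add_div_natCast hp.pos b hz
  add_one z hz := by
    have hp0 : (p : ℂ) ≠ 0 := by exact_mod_cast hp.ne_zero
    have h1 : F (p * (z + 1)) = F (p * z) := by
      rw [mul_add, mul_one, hF.add_natCast (im_natCast_mul hp.pos hz)]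
    have h2 : F ((z + p) / p) = F (z / p) := by
      rw [add_div, div_self hp0, hF.add_one]
      simpa using im_add_div_natCast hp.pos 0 hz
    have h3 := Finset.sum_range_succ' (fun b : ℕ => F ((z + b) / p)) p
    rw [Finset.sum_range_succ, h2] at h3
    simp only [Nat.cast_zero, add_zero] at h3
    rw [_root_.heckeOperator, _root_.heckeOperator, h1, add_right_cancel h3]
    congr 1
    refine Finset.sum_congr rfl fun b _ => ?_
    push_cast
    ring_nf
  neg_inv z hz := by
    have hz0 : z ≠ 0 := by
      rintro rfl
      simp at hz
    have hp0 : (p : ℂ) ≠ 0 := by exact_mod_cast hp.ne_zero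
    have h1 : F (p * -z⁻¹) = F (z / p) := by
      rw [← hF.neg_inv (z / p) (by simpa using im_add_div_natCast hp.pos 0 hz)]
      congr 1
      field_simp
    have h2 : F (-z⁻¹ / p) = F (p * z) := by
      rw [← hF.neg_inv (p * z) (im_natCast_mul hp.pos hz)]
      congr 1
      field_simp
    have h0 : 0 ∈ Finset.range p := Finset.mem_range.mpr hp.pos
    rw [_root_.heckeOperator, _root_.heckeOperator, ← Finset.add_sum_erase _ _ h0,
      ← Finset.add_sum_erase _ _ h0, hF.sum_heckeOperator_neg_inv hp hz]
    simp only [Nat.cast_zero, add_zero, h1, h2]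
    ring

end IsModularFunction

theorem qParam_natCast_mul (p : ℕ) (z : ℂ) :
    Function.Periodic.qParam 1 (p * z) = Function.Periodic.qParam 1 z ^ p := by
  rw [Function.Periodic.qParam, Function.Periodic.qParam, ← Complex.exp_nat_mul]
  congr 1
  ring

theorem qParam_add_div_pow {p : ℕ} (hp : p ≠ 0) (b : ℕ) (z : ℂ) :
    Function.Periodic.qParam 1 ((z + b) / p) ^ p = Function.Periodic.qParam 1 z := by
  have hp0 : (p : ℂ) ≠ 0 := by exact_mod_cast hp
  rw [← qParam_natCast_mul, mul_div_cancel₀ _ hp0]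
  exact Complex.exp_eq_exp_iff_exists_int.mpr ⟨b, by push_cast; ring⟩

theorem sum_qParam_add_div_pow {p : ℕ} (hp : p ≠ 0) (z : ℂ) (n : ℕ) :
    ∑ b ∈ Finset.range p, Function.Periodic.qParam 1 ((z + b) / p) ^ n =
      if p ∣ n then (p : ℂ) * Function.Periodic.qParam 1 z ^ (n / p) else 0 := by
  have hp0 : (p : ℂ) ≠ 0 := by exact_mod_cast hp
  split_ifs with h
  · obtain ⟨m, rfl⟩ := h
    simp [pow_mul, qParam_add_div_pow hp, Nat.mul_div_cancel_left m (Nat.pos_of_ne_zero hp)]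
  · have hζ := Complex.isPrimitiveRoot_exp p hp
    have hsplit : ∀ b : ℕ, Function.Periodic.qParam 1 ((z + b) / p) ^ n =
        Function.Periodic.qParam 1 (z / p) ^ n *
          (Complex.exp (2 * Real.pi * Complex.I / p) ^ n) ^ b := by
      intro b
      simp only [Function.Periodic.qParam, ← Complex.exp_nat_mul, ← Complex.exp_add]
      congr 1
      push_cast
      field_simp
    simp only [hsplit, ← Finset.mul_sum]
    have hne : Complex.exp (2 * Real.pi * Complex.I / p) ^ n ≠ 1 := fun h1 =>
      h ((hζ.pow_eq_one_iff_dvd n).mp h1)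
    rw [geom_sum_eq hne, ← pow_mul, mul_comm n p, pow_mul, hζ.pow_eq_one]
    simp

/-- The action of the Hecke operator on expansions at infinity. -/
theorem evalsTo_heckeOperator {F : ℂ → ℂ} {P : ℤ⟦X⟧} {N p : ℕ} (hp : p ≠ 0)
    (hP : ∀ z : ℂ, 0 < z.im → EvalsTo P (Function.Periodic.qParam 1 z)
      (F z * Function.Periodic.qParam 1 z ^ N)) {z : ℂ} (hz : 0 < z.im) :
    EvalsTo (P.expand p hp + C (p : ℤ) * dissect p (X ^ ((p ^ 2 - 1) * N) * P))
      (Function.Periodic.qParam 1 z)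
      (heckeOperator p F z * Function.Periodic.qParam 1 z ^ (p * N)) := by
  have hpos := Nat.pos_of_ne_zero hp
  rw [heckeOperator, add_mul]
  refine EvalsTo.add (EvalsTo.expand hp ?_) ?_
  · have h1 := hP _ (im_natCast_mul hpos hz)
    rwa [qParam_natCast_mul, ← pow_mul] at h1
  · rw [Finset.sum_mul]
    refine evalsTo_dissect_of_sum hp (sum_qParam_add_div_pow hp z) fun b _ => ?_
    have h1 := ((EvalsTo.X _).pow ((p ^ 2 - 1) * N)).mul (hP _ (im_add_div_natCast hpos b hz))
    convert h1 using 1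
    rw [mul_left_comm, ← pow_add, ← qParam_add_div_pow hp b z, ← pow_mul]
    congr 2
    have : 1 ≤ p ^ 2 := Nat.one_le_pow _ _ hpos
    rw [← Nat.succ_mul, Nat.succ_eq_add_one, Nat.sub_add_cancel this]
    ring

section JInvariant

open UpperHalfPlane ModularForm MatrixGroups ModularGroup ArithmeticFunction.sigma

/-- The modular invariant `j`, extended to `ℂ`. -/
noncomputable def jInvariant (z : ℂ) : ℂ :=
  E₄ (ofComplex z) ^ 3 / discriminant (ofComplex z)

/-- The expansion at infinity of the Eisenstein series `E₄`. -/
noncomputable def eisensteinFourSeries : ℤ⟦X⟧ :=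
  PowerSeries.mk fun n => if n = 0 then 1 else 240 * (σ 3 n : ℤ)

/-- The expansion at infinity of `q * j`. -/
noncomputable def jSeries : ℤ⟦X⟧ := eisensteinFourSeries ^ 3 * partitionSeries ^ 24

theorem apply_ofComplex_add_one {f : ℍ → ℂ} {k : ℤ} (hf : f ∣[k] T = f) {z : ℂ} (hz : 0 < z.im) :
    f (ofComplex (z + 1)) = f (ofComplex z) := by
  have h := congrFun hf ⟨z, hz⟩
  have hd : denom (T : SL(2, ℤ)) (⟨z, hz⟩ : ℍ) = 1 := by
    rw [ModularGroup.denom_apply]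
    simp [T]
  rw [SL_slash_apply, modular_T_smul, hd, one_zpow, mul_one] at h
  rw [ofComplex_apply_of_im_pos hz, ← h,
    ofComplex_apply_of_im_pos (show 0 < (z + 1).im by simpa using hz)]
  have hT : (1 : ℝ) +ᵥ (⟨z, hz⟩ : ℍ) = ⟨z + 1, by simpa using hz⟩ := by
    ext
    simp [add_comm]
  rw [hT]

theorem apply_ofComplex_neg_inv {f : ℍ → ℂ} {k : ℤ} (hf : f ∣[k] S = f) {z : ℂ} (hz : 0 < z.im) :
    f (ofComplex (-z⁻¹)) = f (ofComplex z) * z ^ k := by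
  have hz0 : z ≠ 0 := by
    rintro rfl
    simp at hz
  have h := congrFun hf ⟨z, hz⟩
  rw [SlashInvariantForm.slash_S_apply] at h
  rw [ofComplex_apply_of_im_pos hz, ← h, ofComplex_apply_of_im_pos (im_neg_inv hz)]
  simp [inv_neg, zpow_neg, zpow_ne_zero k hz0]

theorem isModularFunction_jInvariant : IsModularFunction jInvariant where
  differentiableOn := by
    have h1 := UpperHalfPlane.mdifferentiable_iff.mp E₄.holo'
    have h2 := UpperHalfPlane.mdifferentiable_iff.mp CuspForm.discriminant.holo'
    exact (h1.pow 3).div h2 fun z _ => discriminant_ne_zero _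
  add_one z hz := by
    rw [jInvariant, jInvariant, apply_ofComplex_add_one discriminant_T_invariant hz,
      apply_ofComplex_add_one (k := 4) (f := E₄) (E₄.slash_action_eq' _ ⟨T, rfl⟩) hz]
  neg_inv z hz := by
    have hz0 : z ≠ 0 := by
      rintro rfl
      simp at hz
    rw [jInvariant, jInvariant, apply_ofComplex_neg_inv discriminant_S_invariant hz,
      apply_ofComplex_neg_inv (k := 4) (f := E₄) (E₄.slash_action_eq' _ ⟨S, rfl⟩) hz, mul_pow,
      ← zpow_natCast, ← zpow_natCast, ← zpow_mul]
    exact mul_div_mul_right _ _ (zpow_ne_zero _ hz0)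

theorem evalsTo_eisensteinFourSeries {z : ℂ} (hz : 0 < z.im) :
    EvalsTo eisensteinFourSeries (Function.Periodic.qParam 1 z) (E₄ (ofComplex z)) := by
  have h := ModularForm.hasSum_qExpansion E₄ one_pos one_mem_strictPeriods_SL ⟨z, hz⟩
  rw [ofComplex_apply_of_im_pos hz]
  refine h.congr_fun fun n => ?_
  congr 1
  rw [EisensteinSeries.E_qExpansion_coeff _ ⟨2, rfl⟩, eisensteinFourSeries, coeff_mk]
  split_ifs
  · simp
  · norm_num [bernoulli_eq_bernoulli'_of_ne_one, bernoulli'_four]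

theorem evalsTo_jSeries {z : ℂ} (hz : 0 < z.im) :
    EvalsTo jSeries (Function.Periodic.qParam 1 z)
      (jInvariant z * Function.Periodic.qParam 1 z) := by
  have hq : ‖Function.Periodic.qParam 1 z‖ < 1 := Function.Periodic.norm_qParam_lt_one one_pos hz
  have hq0 : Function.Periodic.qParam 1 z ≠ 0 := Function.Periodic.qParam_ne_zero z
  have h := ((evalsTo_eisensteinFourSeries hz).pow 3).mul ((evalsTo_partitionSeries hq).pow 24)
  have hΔ : discriminant (ofComplex z) = Function.Periodic.qParam 1 z *
      (∏' i : ℕ, (1 - Function.Periodic.qParam 1 z ^ (i + 1))) ^ 24 := by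
    rw [discriminant_eq_q_prod, ofComplex_apply_of_im_pos hz,
      ← (multipliable_one_sub_pow hq).tprod_pow]
  unfold jSeries
  convert h using 1
  have := tprod_one_sub_pow_ne_zero hq
  rw [jInvariant, hΔ]
  field_simp

theorem coeff_zero_jSeries : coeff 0 jSeries = 1 := by
  have h1 : constantCoeff eisensteinFourSeries = 1 := by
    rw [← coeff_zero_eq_constantCoeff_apply, eisensteinFourSeries, coeff_mk, if_pos rfl]
  have h2 : constantCoeff partitionSeries = 1 := by
    rw [← coeff_zero_eq_constantCoeff_apply, partitionSeries, coeff_mk]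
    simp
  rw [coeff_zero_eq_constantCoeff_apply, jSeries, map_mul, map_pow, map_pow, h1, h2]
  simp

theorem map_jSeries :
    jSeries.map (Int.castRingHom (ZMod 2)) =
      partitionSeries.map (Int.castRingHom (ZMod 2)) ^ 24 := by
  have h : eisensteinFourSeries.map (Int.castRingHom (ZMod 2)) = 1 := by
    ext n
    rw [coeff_map, eisensteinFourSeries, coeff_mk, coeff_one]
    split_ifs
    · simp
    · rw [map_mul, show Int.castRingHom (ZMod 2) 240 = 0 by decide, zero_mul]
  rw [jSeries, map_mul, map_pow, map_pow, h, one_pow, one_mul]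

end JInvariant

section Parity

local notation "φ" => Int.castRingHom (ZMod 2)

theorem map_dissect {R S : Type*} [Semiring R] [Semiring S] (f : R →+* S) (P : R⟦X⟧) (p : ℕ) :
    (dissect p P).map f = dissect p (P.map f) := by
  ext n
  simp [dissect]

/-- The Hecke operator `T_p` applied to `j ^ m` is a polynomial in `j`. -/
theorem exists_jSeries_relation {p m : ℕ} (hp : p.Prime) (hm : 0 < m) :
    ∃ c : ℕ → ℤ, c (p * m) = 1 ∧
      (jSeries ^ m).expand p hp.ne_zero +
          C (p : ℤ) * dissect p (X ^ ((p ^ 2 - 1) * m) * jSeries ^ m) =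
        ∑ i ∈ Finset.range (p * m + 1), C (c i) * (X ^ (p * m - i) * jSeries ^ i) := by
  have hF : IsModularFunction fun z => jInvariant z ^ m := by
    simpa using isModularFunction_jInvariant.const_mul_pow 1 m
  obtain ⟨c, hc, h⟩ := IsModularFunction.exists_eq_sum_of_evalsTo isModularFunction_jInvariant
    (fun z hz => evalsTo_jSeries hz) coeff_zero_jSeries (p * m) (hF.heckeOperator hp)
    fun z hz => evalsTo_heckeOperator hp.ne_zero (N := m) (P := jSeries ^ m)
      (fun w hw => by simpa only [mul_pow] using (evalsTo_jSeries hw).pow m) hz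
  refine ⟨c, ?_, h⟩
  have h0 : (p ^ 2 - 1) * m ≠ 0 :=
    (Nat.mul_pos (Nat.sub_pos_of_lt (Nat.one_lt_pow two_ne_zero hp.one_lt)) hm).ne'
  have h1 : constantCoeff jSeries = 1 := by
    rw [← coeff_zero_eq_constantCoeff_apply, coeff_zero_jSeries]
  rw [hc, map_add, coeff_C_mul, coeff_expand, if_pos (dvd_zero p), Nat.zero_div, dissect, coeff_mk,
    mul_zero, coeff_X_pow_mul', if_neg (by omega), coeff_zero_eq_constantCoeff_apply, map_pow, h1]
  simp

theorem DensityZero.exponents_map_jSeries_pow (h : DensityZero (exponents (jSeries.map φ)))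
    (k : ℕ) : DensityZero (exponents (jSeries.map φ ^ k)) := by
  induction k using Nat.strong_induction_on with
  | _ k ih =>
    rcases Nat.lt_or_ge k 2 with hk | hk
    · interval_cases k
      · refine Set.Finite.densityZero ((Set.finite_singleton 0).subset fun n hn => ?_)
        by_contra h0
        exact hn (by rw [pow_zero, coeff_one, if_neg (by simpa using h0)])
      · rwa [pow_one]
    · obtain ⟨p, hp, m, rfl⟩ := Nat.exists_prime_and_dvd (show k ≠ 1 by omega)
      have hm : 0 < m := Nat.pos_of_ne_zero fun h0 => by simp [h0] at hk
      have ihm := ih m (lt_mul_of_one_lt_left hm hp.one_lt)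
      obtain ⟨c, hc, hrel⟩ := exists_jSeries_relation hp hm
      rw [Finset.sum_range_succ, hc, Nat.sub_self, pow_zero, one_mul, map_one, one_mul,
        eq_comm, ← eq_sub_iff_add_eq', sub_eq_add_neg, neg_eq_neg_one_mul, ← map_one C, ← map_neg]
        at hrel
      have hmod := congrArg (PowerSeries.map φ) hrel
      simp only [map_add, map_mul, map_expand, map_dissect, map_pow, map_X, map_C, map_sum] at hmod
      rw [hmod, ← map_pow]
      refine DensityZero.exponents_add (DensityZero.exponents_add ?_ ?_)
        (DensityZero.exponents_C_mul ?_ _)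
      · exact (densityZero_exponents_expand hp.ne_zero).mpr ihm
      · exact ((ihm.exponents_X_pow_mul _).exponents_dissect hp.ne_zero).exponents_C_mul _
      · exact DensityZero.exponents_sum _ fun i hi =>
          ((ih i (Finset.mem_range.mp hi)).exponents_X_pow_mul _).exponents_C_mul _

theorem DensityZero.exponents_partitionSeries_pow
    (h : DensityZero (exponents (partitionSeries.map φ ^ 3))) (m : ℕ) :
    DensityZero (exponents (partitionSeries.map φ ^ (3 * m))) := by
  rw [← densityZero_exponents_pow_eight, ← pow_mul, show 3 * m * 8 = 24 * m by ring, pow_mul,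
    ← map_jSeries]
  refine DensityZero.exponents_map_jSeries_pow ?_ m
  rw [map_jSeries, show 24 = 3 * 8 from rfl, pow_mul]
  exact densityZero_exponents_pow_eight.mpr h

theorem coeff_partitionSeries_pow (t n : ℕ) :
    coeff n (partitionSeries ^ t) = multipartition t n := by
  rw [← Fin.prod_const t partitionSeries, coeff_prod, multipartition, Nat.cast_sum]
  refine Finset.sum_nbij' (fun l => ⇑l) Finsupp.equivFunOnFinite.symm ?_ ?_ ?_ ?_ ?_
  · intro l hl
    simpa [Finset.Nat.mem_antidiagonalTuple] using hl
  · intro v hv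
    simpa [Finset.Nat.mem_antidiagonalTuple] using hv
  · intro l _
    exact Finsupp.equivFunOnFinite_symm_coe l
  · intro v _
    rfl
  · intro l _
    simp [partitionSeries]

theorem odd_multipartition_iff (t n : ℕ) :
    Odd (multipartition t n) ↔ n ∈ exponents (partitionSeries.map φ ^ t) := by
  rw [exponents, Set.mem_ofPred_eq, ← map_pow, coeff_map, coeff_partitionSeries_pow, map_natCast,
    ZMod.natCast_ne_zero_iff_odd]

theorem oddCount_eq_ncard (t x : ℕ) :
    oddCount t x = (exponents (partitionSeries.map φ ^ t) ∩ Set.Iio (x + 1)).ncard := by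
  rw [oddCount, ← Set.ncard_coe_finset]
  congr 1
  ext n
  simp [odd_multipartition_iff, and_comm]

theorem hasOddDensity_zero_iff (t : ℕ) :
    hasOddDensity t 0 ↔ DensityZero (exponents (partitionSeries.map φ ^ t)) := by
  simp only [densityZero_iff_tendsto, hasOddDensity, oddCount_eq_ncard]

end Parity

/-- If `δ_A > 0` for some `A ≡ 3 (mod 6)`, and `δ_i` exists for all
`i ≤ A` with `i ≡ 3 (mod 6)`, then `δ_3 > 0`. -/
theorem positive_odd_density_of_cubic_partition_function
    (A : ℕ) (hA0 : 0 < A) (hA6 : A % 6 = 3)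
    (hex : ∀ i : ℕ, 0 < i → i ≤ A → i % 6 = 3 → ∃ δ : ℝ, hasOddDensity i δ)
    (hApos : ∃ δA : ℝ, hasOddDensity A δA ∧ 0 < δA) :
    ∃ δ₃ : ℝ, hasOddDensity 3 δ₃ ∧ 0 < δ₃ := by
  obtain ⟨δ, hδ⟩ := hex 3 (by norm_num) (by omega) (by norm_num)
  refine ⟨δ, hδ, lt_of_le_of_ne (ge_of_tendsto' hδ fun x => by positivity) ?_⟩
  rintro rfl
  obtain ⟨δA, hδA, hpos⟩ := hApos
  obtain ⟨m, rfl⟩ : 3 ∣ A := by omega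
  have hA := (hasOddDensity_zero_iff _).mpr
    (((hasOddDensity_zero_iff 3).mp hδ).exponents_partitionSeries_pow m)
  exact hpos.ne (tendsto_nhds_unique hA hδA)
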